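/- arXiv:2107.14453 — 2 statements merged into one kernel-verified Lean document; each statement's English description precedes it below -/
import Mathlib

section
/- Let η > 0 and 0 < T ≤ ∞. Suppose a : [0,T) → ℝ is nonnegative, locally integrable and nondecreasing on [0,T); suppose g : [0,T) → ℝ is nonnegative, nondecreasing, continuous, and bounded by a constant M; and suppose f : [0,T) → ℝ is nonnegative and locally integrable on [0,T) and satisfies f(t) ≤ a(t) + g(t) ∫₀ᵗ (t−s)^{η−1} f(s) ds for all t ∈ [0,T). Then f(t) ≤ a(t) · E_η( g(t) Γ(η) t^η ) for all t ∈ [0,T). -/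
open MeasureTheory Real ENNReal

/-- The Mittag-Leffler function `E_η(z) = ∑_{k=0}^∞ z^k / Γ(kη + 1)`. -/
noncomputable def mittagLeffler (η z : ℝ) : ℝ :=
  ∑' k : ℕ, z ^ k / Real.Gamma (k * η + 1)

/-- The Riemann–Liouville kernel `x ↦ x₊^(β-1) / Γ(β)`, the kernel of fractional integration of
order `β`. -/
noncomputable def rlKernel (β x : ℝ) : ℝ≥0∞ :=
  if 0 < x then ENNReal.ofReal (x ^ (β - 1) / Real.Gamma β) else 0

lemma rlKernel_of_pos {β x : ℝ} (hx : 0 < x) :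
    rlKernel β x = ENNReal.ofReal (x ^ (β - 1) / Real.Gamma β) := if_pos hx

lemma rlKernel_of_nonpos {β x : ℝ} (hx : x ≤ 0) : rlKernel β x = 0 := if_neg hx.not_gt

@[fun_prop]
lemma measurable_rlKernel (β : ℝ) : Measurable (rlKernel β) :=
  Measurable.ite measurableSet_Ioi (by fun_prop) (by fun_prop)

lemma lintegral_eq_ofReal_mul_lintegral_comp_mul_left {φ : ℝ → ℝ≥0∞} (hφ : Measurable φ) {a : ℝ}
    (ha : 0 < a) : ∫⁻ x, φ x = ENNReal.ofReal a * ∫⁻ x, φ (a * x) := by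
  conv_lhs => rw [← Real.smul_map_volume_mul_left ha.ne', lintegral_smul_measure,
    lintegral_map hφ (measurable_const_mul a), abs_of_pos ha, smul_eq_mul]

/-- Semigroup property of the Riemann–Liouville kernels. -/
lemma rlKernel_lconvolution_rlKernel {α β : ℝ} (hα : 0 < α) (hβ : 0 < β) :
    rlKernel α ⋆ₗ rlKernel β = rlKernel (α + β) := by
  ext x
  rw [lconvolution_def]
  rcases le_or_gt x 0 with hx | hx
  · rw [rlKernel_of_nonpos hx, lintegral_eq_zero_iff (by fun_prop)]
    refine Filter.Eventually.of_forall fun y => ?_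
    rcases le_or_gt y 0 with hy | hy
    · simp [rlKernel_of_nonpos hy]
    · simp [rlKernel_of_nonpos (show -y + x ≤ 0 by linarith)]
  · have hΓα := Real.Gamma_pos_of_pos hα
    have hΓβ := Real.Gamma_pos_of_pos hβ
    have hΓ := Real.Gamma_pos_of_pos (add_pos hα hβ)
    have key : ∀ u, rlKernel α (x * u) * rlKernel β (-(x * u) + x) =
        ENNReal.ofReal (x ^ (α + β - 2) / Real.Gamma (α + β)) *
          ProbabilityTheory.betaPDF α β u := by
      intro u
      rcases le_or_gt u 0 with hu | hu
      · rw [rlKernel_of_nonpos (mul_nonpos_of_nonneg_of_nonpos hx.le hu),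
          ProbabilityTheory.betaPDF_eq_zero_of_nonpos hu, zero_mul, mul_zero]
      rcases le_or_gt 1 u with hu1 | hu1
      · rw [rlKernel_of_nonpos (show -(x * u) + x ≤ 0 by nlinarith),
          ProbabilityTheory.betaPDF_eq_zero_of_one_le hu1, mul_zero, mul_zero]
      have h1 : 0 < 1 - u := sub_pos.2 hu1
      have hxu : -(x * u) + x = x * (1 - u) := by ring
      rw [hxu, rlKernel_of_pos (mul_pos hx hu), rlKernel_of_pos (mul_pos hx h1),
        ProbabilityTheory.betaPDF_of_pos_lt_one hu hu1, ← ENNReal.ofReal_mul (by positivity),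
        ← ENNReal.ofReal_mul (by positivity), Real.mul_rpow hx.le hu.le,
        Real.mul_rpow hx.le h1.le, show α + β - 2 = (α - 1) + (β - 1) by ring, Real.rpow_add hx,
        ProbabilityTheory.beta]
      congr 1
      field_simp
    rw [lintegral_eq_ofReal_mul_lintegral_comp_mul_left (by fun_prop) hx]
    simp_rw [key]
    rw [lintegral_const_mul' _ _ ENNReal.ofReal_ne_top,
      ProbabilityTheory.lintegral_betaPDF_eq_one hα hβ, mul_one, rlKernel_of_pos hx,
      ← ENNReal.ofReal_mul hx.le, show α + β - 1 = 1 + (α + β - 2) by ring, Real.rpow_add hx,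
      Real.rpow_one, mul_div_assoc]

/-- Iterating a linear Volterra inequality with Riemann–Liouville kernel. -/
lemma le_sum_rlKernel_add_lconvolution {η : ℝ} (hη : 0 < η) {F : ℝ → ℝ≥0∞} (hF : AEMeasurable F)
    {A C : ℝ≥0∞} (hC : C ≠ ∞)
    (h : ∀ s, F s ≤ A * rlKernel 1 s + C * (F ⋆ₗ rlKernel η) s) (n : ℕ) (s : ℝ) :
    F s ≤ ∑ k ∈ Finset.range (n + 1), A * C ^ k * rlKernel (k * η + 1) s +
      C ^ (n + 1) * (F ⋆ₗ rlKernel ((n + 1) * η)) s := by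
  induction n with
  | zero => simpa using h s
  | succ n ih =>
    have hn : 0 < ((n : ℝ) + 1) * η := by positivity
    have step : (F ⋆ₗ rlKernel ((n + 1) * η)) s ≤ A * rlKernel ((n + 1) * η + 1) s +
        C * (F ⋆ₗ rlKernel ((n + 1 + 1) * η)) s := by
      have hsplit : (n + 1 + 1) * η = η + (n + 1) * η := by ring
      rw [hsplit, ← rlKernel_lconvolution_rlKernel hη hn,
        lconvolution_assoc₀ hF (measurable_rlKernel _).aemeasurable
          (measurable_rlKernel _).aemeasurable, add_comm (((n : ℝ) + 1) * η) 1,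
        ← rlKernel_lconvolution_rlKernel one_pos hn]
      simp only [lconvolution_def (g := rlKernel ((n + 1) * η))]
      rw [← lintegral_const_mul' _ _ hC, ← lintegral_const_mul _ (by fun_prop),
        ← lintegral_add_left (by fun_prop)]
      refine lintegral_mono fun y => ?_
      rw [← mul_assoc, ← mul_assoc, ← add_mul]
      gcongr
      exact h y
    refine ih.trans ?_
    rw [Finset.sum_range_succ _ (n + 1), add_assoc]
    gcongr
    calc _ ≤ C ^ (n + 1) * (A * rlKernel ((n + 1) * η + 1) s +
        C * (F ⋆ₗ rlKernel ((n + 1 + 1) * η)) s) := by gcongr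
      _ = _ := by push_cast; ring

lemma rpow_mul_exp_neg_le_Gamma {R x : ℝ} (hR : 0 < R) (hx : 1 ≤ x) :
    R ^ (x - 1) * Real.exp (-R) ≤ Real.Gamma x := by
  have hint := Real.GammaIntegral_convergent (zero_lt_one.trans_le hx)
  have hsub : Set.Ioi R ⊆ Set.Ioi 0 := Set.Ioi_subset_Ioi hR.le
  rw [Real.Gamma_eq_integral (zero_lt_one.trans_le hx), ← integral_exp_neg_Ioi,
    ← integral_const_mul]
  calc ∫ t in Set.Ioi R, R ^ (x - 1) * Real.exp (-t)
      ≤ ∫ t in Set.Ioi R, Real.exp (-t) * t ^ (x - 1) := by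
        refine setIntegral_mono_on ((integrableOn_exp_neg_Ioi R).const_mul _) (hint.mono_set hsub)
          measurableSet_Ioi fun t ht => ?_
        rw [mul_comm]
        have : R ^ (x - 1) ≤ t ^ (x - 1) :=
          Real.rpow_le_rpow hR.le (le_of_lt ht) (by linarith)
        gcongr
    _ ≤ ∫ t in Set.Ioi 0, Real.exp (-t) * t ^ (x - 1) := by
        refine setIntegral_mono_set hint ?_ hsub.eventuallyLE
        filter_upwards [ae_restrict_mem measurableSet_Ioi] with t ht
        have : (0 : ℝ) < t := ht
        simp only [Pi.zero_apply]
        positivity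

lemma exists_pos_rpow_eq {η : ℝ} (hη : 0 < η) {r : ℝ} (hr : 0 < r) : ∃ R, 0 < R ∧ R ^ η = r :=
  ⟨r ^ η⁻¹, by positivity, Real.rpow_inv_rpow hr.le hη.ne'⟩

lemma summable_mittagLeffler {η z : ℝ} (hη : 0 < η) (hz : 0 ≤ z) :
    Summable fun k : ℕ => z ^ k / Real.Gamma (k * η + 1) := by
  obtain ⟨R, hR, hRz⟩ := exists_pos_rpow_eq hη (show 0 < z + 1 by linarith)
  have hgeom : Summable fun k : ℕ => Real.exp R * (z / (z + 1)) ^ k :=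
    (summable_geometric_of_lt_one (by positivity)
      ((div_lt_one (by linarith)).2 (by linarith))).mul_left _
  refine hgeom.of_nonneg_of_le (fun k => ?_) fun k => ?_
  · have := Real.Gamma_pos_of_pos (show 0 < k * η + 1 by positivity)
    positivity
  · have hΓ := rpow_mul_exp_neg_le_Gamma hR (show 1 ≤ k * η + 1 by
      have : 0 ≤ k * η := by positivity
      linarith)
    rw [add_sub_cancel_right, mul_comm (k : ℝ), Real.rpow_mul hR.le, hRz, Real.rpow_natCast] at hΓ
    rw [mul_comm (k : ℝ)]
    calc _ ≤ z ^ k / ((z + 1) ^ k * Real.exp (-R)) := by gcongr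
      _ = _ := by rw [Real.exp_neg, div_pow]; field_simp

lemma tendsto_pow_mul_rpow_div_Gamma {η c t : ℝ} (hη : 0 < η) (hc : 0 ≤ c) (ht : 0 < t) :
    Filter.Tendsto (fun n : ℕ => c ^ n * (t ^ (n * η - 1) / Real.Gamma (n * η))) Filter.atTop
      (nhds 0) := by
  set z := c * t ^ η with hz
  have hz0 : 0 ≤ z := by positivity
  obtain ⟨R, hR, hRz⟩ := exists_pos_rpow_eq hη (show 0 < z + 1 by linarith)
  have hgeom : Filter.Tendsto (fun n : ℕ => R * Real.exp R / t * (z / (z + 1)) ^ n) Filter.atTop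
      (nhds 0) := by
    simpa using (tendsto_pow_atTop_nhds_zero_of_lt_one (by positivity)
      ((div_lt_one (by linarith)).2 (by linarith : z < z + 1))).const_mul (R * Real.exp R / t)
  obtain ⟨N, hN⟩ := exists_nat_ge η⁻¹
  refine squeeze_zero' ?_ ?_ hgeom
  · refine Filter.Eventually.of_forall fun n => ?_
    have := Real.Gamma_nonneg_of_nonneg (show 0 ≤ n * η by positivity)
    positivity
  · filter_upwards [Filter.eventually_ge_atTop N] with n hn
    have h1 : 1 ≤ n * η := by
      have : (N : ℝ) ≤ n := by exact_mod_cast hn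
      exact (inv_le_iff_one_le_mul₀ hη).1 (by linarith)
    have hΓ := rpow_mul_exp_neg_le_Gamma hR h1
    rw [Real.rpow_sub_one hR.ne', mul_comm (n : ℝ), Real.rpow_mul hR.le, hRz,
      Real.rpow_natCast] at hΓ
    rw [mul_comm (n : ℝ), Real.rpow_sub_one ht.ne', Real.rpow_mul ht.le, Real.rpow_natCast]
    calc _ ≤ c ^ n * ((t ^ η) ^ n / t / ((z + 1) ^ n / R * Real.exp (-R))) := by gcongr
      _ = _ := by
        rw [Real.exp_neg, div_pow, hz, mul_pow]
        field_simp

lemma mittagLeffler_zero (η : ℝ) : mittagLeffler η 0 = 1 := by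
  rw [mittagLeffler, tsum_eq_single 0 fun k hk => by simp [hk]]
  simp

/-- Fractional Gronwall inequality with constant coefficients, in terms of lower integrals. -/
lemma le_mul_mittagLeffler_of_le_lconvolution {η : ℝ} (hη : 0 < η) {F : ℝ → ℝ≥0∞}
    (hF : AEMeasurable F) (hF_int : ∫⁻ s, F s ≠ ∞) (hF_zero : ∀ s ≤ 0, F s = 0) {A c : ℝ}
    (hA : 0 ≤ A) (hc : 0 ≤ c)
    (h : ∀ s, F s ≤ ENNReal.ofReal A * rlKernel 1 s + ENNReal.ofReal c * (F ⋆ₗ rlKernel η) s)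
    {t : ℝ} (ht : 0 < t) :
    F t ≤ ENNReal.ofReal (A * mittagLeffler η (c * t ^ η)) := by
  have hz : 0 ≤ c * t ^ η := by positivity
  have hterm : ∀ k : ℕ, 0 ≤ (c * t ^ η) ^ k / Real.Gamma (k * η + 1) := fun k => by
    have := Real.Gamma_pos_of_pos (show 0 < k * η + 1 by positivity)
    positivity
  have hsum : ∀ n : ℕ, ∑ k ∈ Finset.range n,
      ENNReal.ofReal A * ENNReal.ofReal c ^ k * rlKernel (k * η + 1) t ≤
        ENNReal.ofReal (A * mittagLeffler η (c * t ^ η)) := by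
    intro n
    have hk : ∀ k : ℕ, ENNReal.ofReal A * ENNReal.ofReal c ^ k * rlKernel (k * η + 1) t =
        ENNReal.ofReal (A * ((c * t ^ η) ^ k / Real.Gamma (k * η + 1))) := by
      intro k
      rw [rlKernel_of_pos ht, ← ENNReal.ofReal_pow hc, ← ENNReal.ofReal_mul hA,
        ← ENNReal.ofReal_mul (by positivity), add_sub_cancel_right, mul_pow,
        ← Real.rpow_mul_natCast ht.le, mul_comm η]
      congr 1
      ring
    simp_rw [hk]
    rw [← ENNReal.ofReal_sum_of_nonneg fun k _ => mul_nonneg hA (hterm k), ← Finset.mul_sum]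
    gcongr
    exact (summable_mittagLeffler hη hz).sum_le_tsum _ fun k _ => hterm k
  have hrem : Filter.Tendsto (fun n : ℕ => ENNReal.ofReal (A * mittagLeffler η (c * t ^ η)) +
      ENNReal.ofReal (c ^ (n + 1) * (t ^ ((n + 1 : ℕ) * η - 1) / Real.Gamma ((n + 1 : ℕ) * η))) *
        ∫⁻ s, F s) Filter.atTop (nhds (ENNReal.ofReal (A * mittagLeffler η (c * t ^ η)))) := by
    have h0 := ENNReal.Tendsto.mul_const (b := ∫⁻ s, F s) (ENNReal.tendsto_ofReal
      ((Filter.tendsto_add_atTop_iff_nat 1).2 (tendsto_pow_mul_rpow_div_Gamma hη hc ht)))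
      (Or.inr hF_int)
    simpa using h0.const_add (ENNReal.ofReal (A * mittagLeffler η (c * t ^ η)))
  obtain ⟨N, hN⟩ := exists_nat_ge η⁻¹
  refine ge_of_tendsto hrem ?_
  filter_upwards [Filter.eventually_ge_atTop N] with n hn
  refine (le_sum_rlKernel_add_lconvolution hη hF ENNReal.ofReal_ne_top h n t).trans ?_
  refine add_le_add (hsum _) ?_
  have h1 : 1 ≤ ((n : ℝ) + 1) * η := by
    have : (N : ℝ) ≤ n := by exact_mod_cast hn
    exact (inv_le_iff_one_le_mul₀ hη).1 (by linarith)
  have hΓ := Real.Gamma_pos_of_pos (zero_lt_one.trans_le h1)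
  rw [ENNReal.ofReal_mul (by positivity), ENNReal.ofReal_pow hc, mul_assoc, lconvolution_def,
    ← lintegral_const_mul' _ _ ENNReal.ofReal_ne_top]
  push_cast
  refine mul_le_mul_right (lintegral_mono fun s => ?_) _
  rw [mul_comm]
  rcases le_or_gt s 0 with hs | hs
  · simp [hF_zero s hs]
  gcongr
  rcases le_or_gt (-s + t) 0 with hst | hst
  · simp [rlKernel_of_nonpos hst]
  · rw [rlKernel_of_pos hst]
    gcongr
    · linarith

/-- Generalised (fractional) Gronwall inequality.  `T` is an extended nonnegative
real, so `T = ∞` is allowed; the relevant time interval `[0, T)` is the set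
`S = {t : ℝ | 0 ≤ t ∧ ofReal t < T}`. -/
theorem generalized_gronwall_inequality
    (η : ℝ) (hη : 0 < η) (T : ℝ≥0∞) (hT : 0 < T)
    (S : Set ℝ) (hS : S = {t : ℝ | 0 ≤ t ∧ ENNReal.ofReal t < T})
    (a g f : ℝ → ℝ)
    (ha_nonneg : ∀ t ∈ S, 0 ≤ a t)
    (ha_loc : ∀ t ∈ S, IntegrableOn a (Set.Icc 0 t))
    (ha_mono : MonotoneOn a S)
    (hg_nonneg : ∀ t ∈ S, 0 ≤ g t)
    (hg_mono : MonotoneOn g S)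
    (hg_cont : ContinuousOn g S)
    (M : ℝ) (hg_bdd : ∀ t ∈ S, g t ≤ M)
    (hf_nonneg : ∀ t ∈ S, 0 ≤ f t)
    (hf_loc : ∀ t ∈ S, IntegrableOn f (Set.Icc 0 t))
    (hineq : ∀ t ∈ S, f t ≤ a t + g t * ∫ s in (0:ℝ)..t, (t - s) ^ (η - 1) * f s) :
    ∀ t ∈ S, f t ≤ a t * mittagLeffler η (g t * Real.Gamma η * t ^ η) := by
  have hS_mem : ∀ {t}, t ∈ S → ∀ {s}, 0 ≤ s → s ≤ t → s ∈ S := by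
    intro t ht s hs hst
    rw [hS] at ht ⊢
    exact ⟨hs, (ENNReal.ofReal_le_ofReal hst).trans_lt ht.2⟩
  intro t ht
  have ht0 : 0 ≤ t := by
    rw [hS] at ht
    exact ht.1
  rcases ht0.eq_or_lt with rfl | htpos
  · simpa [Real.zero_rpow hη.ne', mittagLeffler_zero] using hineq 0 ht
  have hΓ := Real.Gamma_pos_of_pos hη
  have hA := ha_nonneg t ht
  have hG := hg_nonneg t ht
  have hfint : IntegrableOn f (Set.Ioc 0 t) := (hf_loc t ht).mono_set Set.Ioc_subset_Icc_self
  set F : ℝ → ℝ≥0∞ := (Set.Ioc 0 t).indicator fun s => ENNReal.ofReal (f s) with hFdef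
  have hF_meas : AEMeasurable F :=
    (aemeasurable_indicator_iff measurableSet_Ioc).2 hfint.aemeasurable.ennreal_ofReal
  have hF_int : ∫⁻ s, F s ≠ ∞ := by
    rw [hFdef, lintegral_indicator measurableSet_Ioc]
    exact hfint.lintegral_lt_top.ne
  have hconv : ∀ s ∈ Set.Ioc 0 t, ENNReal.ofReal (∫ y in (0 : ℝ)..s, (s - y) ^ (η - 1) * f y) ≤
      ENNReal.ofReal (Real.Gamma η) * (F ⋆ₗ rlKernel η) s := by
    intro s hs
    have hnonneg : ∀ y ∈ Set.Ioo 0 s, 0 ≤ f y := fun y hy =>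
      hf_nonneg y (hS_mem ht hy.1.le (hy.2.le.trans hs.2))
    rw [intervalIntegral.integral_of_le hs.1.le, integral_Ioc_eq_integral_Ioo, lconvolution_def,
      ← lintegral_const_mul' _ _ ENNReal.ofReal_ne_top]
    calc _ ≤ ∫⁻ y in Set.Ioo 0 s, ‖(s - y) ^ (η - 1) * f y‖ₑ :=
          (Real.ofReal_le_enorm _).trans (enorm_integral_le_lintegral_enorm _)
      _ = ∫⁻ y in Set.Ioo 0 s, ENNReal.ofReal (Real.Gamma η) * (F y * rlKernel η (-y + s)) := by
          refine setLIntegral_congr_fun measurableSet_Ioo fun y hy => ?_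
          have hsy : 0 < s - y := sub_pos.2 hy.2
          have hfy := hnonneg y hy
          have hyt : y ∈ Set.Ioc 0 t := ⟨hy.1, hy.2.le.trans hs.2⟩
          simp only [hFdef, Set.indicator_of_mem hyt]
          rw [neg_add_eq_sub, rlKernel_of_pos hsy, ← ENNReal.ofReal_mul hfy,
            ← ENNReal.ofReal_mul hΓ.le, Real.enorm_of_nonneg (by positivity)]
          congr 1
          field_simp
      _ ≤ _ := setLIntegral_le_lintegral _ _
  have hF_le : ∀ s, F s ≤ ENNReal.ofReal (a t) * rlKernel 1 s +
      ENNReal.ofReal (g t * Real.Gamma η) * (F ⋆ₗ rlKernel η) s := by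
    intro s
    by_cases hs : s ∈ Set.Ioc 0 t
    · have hsS := hS_mem ht hs.1.le hs.2
      rw [hFdef, Set.indicator_of_mem hs, ← hFdef, rlKernel_of_pos hs.1, ENNReal.ofReal_mul hG,
        mul_assoc]
      calc ENNReal.ofReal (f s)
          ≤ ENNReal.ofReal (a s) +
            ENNReal.ofReal (g s) *
              ENNReal.ofReal (∫ y in (0 : ℝ)..s, (s - y) ^ (η - 1) * f y) := by
            rw [← ENNReal.ofReal_mul (hg_nonneg s hsS)]
            exact (ENNReal.ofReal_le_ofReal (hineq s hsS)).trans ENNReal.ofReal_add_le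
        _ ≤ _ := by
            simp only [sub_self, Real.rpow_zero, Real.Gamma_one, div_one, ENNReal.ofReal_one,
              mul_one]
            gcongr
            · exact ha_mono hsS ht hs.2
            · exact hg_mono hsS ht hs.2
            · exact hconv s hs
    · simp [hFdef, hs]
  have hmain := le_mul_mittagLeffler_of_le_lconvolution hη hF_meas hF_int
    (fun s hs => Set.indicator_of_notMem (fun h => h.1.not_ge hs) _) hA
    (mul_nonneg hG hΓ.le) hF_le htpos
  rw [hFdef, Set.indicator_of_mem (Set.right_mem_Ioc.2 htpos)] at hmain
  refine (ENNReal.ofReal_le_ofReal_iff (mul_nonneg hA (tsum_nonneg fun k => ?_))).1 hmain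
  have := Real.Gamma_pos_of_pos (show 0 < k * η + 1 by positivity)
  positivity
end

section
/- Let C > 0, T > 0, and let f : [0,T] → ℝ be a nonnegative bounded measurable function satisfying f(t) ≤ C ∫₀ᵗ (t−s)^{−1/2} f(s) ds for every t ∈ [0,T]. Then f(t) = 0 for every t ∈ [0,T]. -/
open MeasureTheory

/-- The integrand of the Gamma integral with rate `r` is integrable on `(0, ∞)`. -/
lemma integrableOn_rpow_neg_half_mul_exp {r : ℝ} (hr : 0 < r) :
    IntegrableOn (fun u : ℝ => u ^ (-(1:ℝ)/2) * Real.exp (-(r * u))) (Set.Ioi 0) := by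
  simpa using integrableOn_rpow_mul_exp_neg_mul_rpow (p := 1) (s := -(1:ℝ)/2) (b := r)
    (by norm_num) one_pos hr

lemma intervalIntegrable_rpow_neg_half_mul_exp {r t : ℝ} (hr : 0 < r) (ht : 0 ≤ t) :
    IntervalIntegrable (fun s : ℝ => (t - s) ^ (-(1:ℝ)/2) * Real.exp (r * s)) volume 0 t := by
  have h : IntervalIntegrable (fun u : ℝ => u ^ (-(1:ℝ)/2) * Real.exp (-(r * u))) volume 0 t :=
    (intervalIntegrable_iff_integrableOn_Ioc_of_le ht).2
      ((integrableOn_rpow_neg_half_mul_exp hr).mono_set Set.Ioc_subset_Ioi_self)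
  have h' := ((h.comp_sub_left t).symm).const_mul (Real.exp (r * t))
  simp only [sub_zero, sub_self] at h'
  refine h'.congr fun s _ => ?_
  have : Real.exp (r * s) = Real.exp (r * t) * Real.exp (-(r * (t - s))) := by
    rw [← Real.exp_add]; ring_nf
  simp only [this]; ring

/-- An exponential of rate `r` has half-order Abel transform at most `Γ(1/2) r ^ (-1/2)` times
itself. -/
lemma integral_rpow_neg_half_mul_exp_le {r t : ℝ} (hr : 0 < r) (ht : 0 ≤ t) :
    ∫ s in (0:ℝ)..t, (t - s) ^ (-(1:ℝ)/2) * Real.exp (r * s) ≤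
      Real.exp (r * t) * √(Real.pi / r) := by
  have h_subst : ∫ s in (0:ℝ)..t, (t - s) ^ (-(1:ℝ)/2) * Real.exp (r * s) =
      Real.exp (r * t) * ∫ u in (0:ℝ)..t, u ^ (-(1:ℝ)/2) * Real.exp (-(r * u)) := by
    have h := intervalIntegral.integral_comp_sub_left (a := 0) (b := t)
      (fun u : ℝ => u ^ (-(1:ℝ)/2) * Real.exp (-(r * u))) t
    simp only [sub_zero, sub_self] at h
    rw [← h, ← intervalIntegral.integral_const_mul]
    congr 1 with s
    have : Real.exp (r * s) = Real.exp (r * t) * Real.exp (-(r * (t - s))) := by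
      rw [← Real.exp_add]; ring_nf
    rw [this]; ring
  have h_gamma : ∫ u in Set.Ioi (0:ℝ), u ^ (-(1:ℝ)/2) * Real.exp (-(r * u)) =
      √(Real.pi / r) := by
    have h := Real.integral_rpow_mul_exp_neg_mul_Ioi (a := 1 / 2) (by norm_num) hr
    rw [Real.Gamma_one_half_eq, ← Real.sqrt_eq_rpow, ← Real.sqrt_mul (by positivity)] at h
    rw [show -(1:ℝ)/2 = 1 / 2 - 1 by norm_num, h]
    ring_nf
  rw [h_subst, ← h_gamma, intervalIntegral.integral_of_le ht]
  refine mul_le_mul_of_nonneg_left ?_ (Real.exp_pos _).le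
  refine setIntegral_mono_set (integrableOn_rpow_neg_half_mul_exp hr) ?_
    Set.Ioc_subset_Ioi_self.eventuallyLE
  filter_upwards [ae_restrict_mem measurableSet_Ioi] with u hu
  exact mul_nonneg (Real.rpow_nonneg (le_of_lt hu) _) (Real.exp_pos _).le

/-- If a nonnegative bounded measurable function `f` on `[0,T]` satisfies
`f(t) ≤ C ∫₀ᵗ (t-s)^{-1/2} f(s) ds` for every `t ∈ [0,T]`, then `f ≡ 0` on `[0,T]`. -/
theorem vanishing_from_singular_gronwall
    (C T : ℝ) (hC : 0 < C) (hT : 0 < T)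
    (f : ℝ → ℝ) (hf_meas : Measurable f)
    (hf_nonneg : ∀ t ∈ Set.Icc (0:ℝ) T, 0 ≤ f t)
    (hf_bdd : ∃ M : ℝ, ∀ t ∈ Set.Icc (0:ℝ) T, f t ≤ M)
    (hineq : ∀ t ∈ Set.Icc (0:ℝ) T,
      f t ≤ C * ∫ s in (0:ℝ)..t, (t - s) ^ (-(1:ℝ)/2) * f s) :
    ∀ t ∈ Set.Icc (0:ℝ) T, f t = 0 := by
  obtain ⟨M, hM⟩ := hf_bdd
  have hM0 : 0 ≤ M := (hf_nonneg 0 ⟨le_rfl, hT.le⟩).trans (hM 0 ⟨le_rfl, hT.le⟩)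
  obtain ⟨r, hr, hCr⟩ : ∃ r : ℝ, 0 < r ∧ C * √(Real.pi / r) = 1 / 2 := by
    have hpi := Real.pi_pos
    refine ⟨Real.pi * (2 * C) ^ 2, by positivity, ?_⟩
    rw [show Real.pi / (Real.pi * (2 * C) ^ 2) = (1 / (2 * C)) ^ 2 by field_simp,
      Real.sqrt_sq (by positivity)]
    field_simp
  have hbound (n : ℕ) : ∀ t ∈ Set.Icc (0:ℝ) T, f t ≤ M * (1 / 2) ^ n * Real.exp (r * t) := by
    induction n with
    | zero =>
      intro t ht
      have h1 : 1 ≤ Real.exp (r * t) := Real.one_le_exp (mul_nonneg hr.le ht.1)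
      simpa using (hM t ht).trans (le_mul_of_one_le_right hM0 h1)
    | succ n ih =>
      intro t ht
      have hB : 0 ≤ M * (1 / 2 : ℝ) ^ n := by positivity
      have h_mono : ∫ s in (0:ℝ)..t, (t - s) ^ (-(1:ℝ)/2) * f s ≤
          ∫ s in (0:ℝ)..t, M * (1 / 2) ^ n * ((t - s) ^ (-(1:ℝ)/2) * Real.exp (r * s)) := by
        rw [intervalIntegral.integral_of_le ht.1, intervalIntegral.integral_of_le ht.1]
        refine integral_mono_of_nonneg ?_
          ((intervalIntegrable_rpow_neg_half_mul_exp hr ht.1).const_mul _).1 ?_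
        all_goals
          filter_upwards [ae_restrict_mem measurableSet_Ioc] with s hs
          have hsT : s ∈ Set.Icc (0:ℝ) T := ⟨hs.1.le, hs.2.trans ht.2⟩
          have hk : 0 ≤ (t - s) ^ (-(1:ℝ)/2) := Real.rpow_nonneg (sub_nonneg.2 hs.2) _
        · exact mul_nonneg hk (hf_nonneg s hsT)
        · exact (mul_le_mul_of_nonneg_left (ih s hsT) hk).trans_eq (by ring)
      rw [intervalIntegral.integral_const_mul] at h_mono
      calc f t ≤ C * ∫ s in (0:ℝ)..t, (t - s) ^ (-(1:ℝ)/2) * f s := hineq t ht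
        _ ≤ C * (M * (1 / 2) ^ n * (Real.exp (r * t) * √(Real.pi / r))) := by
          refine mul_le_mul_of_nonneg_left (h_mono.trans ?_) hC.le
          exact mul_le_mul_of_nonneg_left (integral_rpow_neg_half_mul_exp_le hr ht.1) hB
        _ = M * (1 / 2) ^ n * Real.exp (r * t) * (C * √(Real.pi / r)) := by ring
        _ = M * (1 / 2) ^ (n + 1) * Real.exp (r * t) := by rw [hCr]; ring
  intro t ht
  refine le_antisymm ?_ (hf_nonneg t ht)
  have hlim : Filter.Tendsto (fun n : ℕ => M * (1 / 2 : ℝ) ^ n * Real.exp (r * t))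
      Filter.atTop (nhds 0) := by
    simpa using ((tendsto_pow_atTop_nhds_zero_of_lt_one (r := (1 / 2 : ℝ)) (by norm_num)
      (by norm_num)).const_mul M).mul_const (Real.exp (r * t))
  exact ge_of_tendsto' hlim fun n => hbound n t ht
end
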